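/- arXiv:1804.01487 — 14 statements merged into one kernel-verified Lean document; each statement's English description precedes it below -/
import Mathlib

section
/- Let σ be a nonempty clique of G. Then σ ∈ FP(G) if and only if σ is target-free, i.e., there is no node k ∉ σ receiving an edge from every node of σ. -/
open scoped Classical

/-- The CTLN connectivity matrix built from a directed graph (edge relation `E`,
where `E j i` means there is an edge from `j` to `i`) and parameters `ε, δ`. -/
noncomputable def ctlnW {V : Type} [Fintype V] (E : V → V → Prop) (ε δ : ℝ) :
    Matrix V V ℝ :=
  fun i j => if i = j then 0 else if E j i then -1 + ε else -1 - δ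

/-- `x` is a fixed point of the CTLN: `x i = [∑ⱼ W i j * x j + θ]₊` for all `i`. -/
def IsCTLNFixedPoint {V : Type} [Fintype V] (E : V → V → Prop) (ε δ θ : ℝ)
    (x : V → ℝ) : Prop :=
  ∀ i, x i = max 0 ((∑ j, ctlnW E ε δ i j * x j) + θ)

/-- `FP E ε δ θ` : the collection of subsets that arise as supports of fixed
points of the CTLN. -/
noncomputable def FP {V : Type} [Fintype V] (E : V → V → Prop) (ε δ θ : ℝ) :
    Finset (Finset V) :=
  Finset.univ.filter fun σ =>
    ∃ x : V → ℝ, IsCTLNFixedPoint E ε δ θ x ∧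
      (Finset.univ.filter fun i => x i ≠ 0) = σ

/-- The submatrix `W_σ` of the CTLN matrix, with rows and columns indexed by `σ`. -/
noncomputable def ctlnWSub {V : Type} [Fintype V] (E : V → V → Prop) (ε δ : ℝ)
    (σ : Finset V) : Matrix σ σ ℝ :=
  fun i j => ctlnW E ε δ i.1 j.1

/-- A nonempty clique `σ` is in `FP(G)` iff it is target-free. -/
theorem clique_mem_FP_iff_target_free {n : ℕ} (hn : 1 ≤ n) (E : Fin n → Fin n → Prop)
    (hirr : ∀ i, ¬ E i i) (ε δ θ : ℝ)
    (hθ : 0 < θ) (hδ : 0 < δ) (hε : 0 < ε) (hεδ : ε < δ / (δ + 1))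
    (σ : Finset (Fin n)) (hne : σ.Nonempty)
    (hclique : ∀ i ∈ σ, ∀ j ∈ σ, i ≠ j → E i j ∧ E j i) :
    σ ∈ FP E ε δ θ ↔ ¬ ∃ k, k ∉ σ ∧ ∀ i ∈ σ, E i k := by
  have hε1 : ε < 1 := by
    refine hεδ.trans ?_
    rw [div_lt_one (by linarith)]; linarith
  have hrow : ∀ i ∈ σ, ∀ j ∈ σ, ∀ t : ℝ, ctlnW E ε δ i j * t =
      (-1 + ε) * t - (if i = j then (-1 + ε) * t else 0) := by
    intro i hi j hj t
    by_cases h : i = j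
    · simp [ctlnW, h]
    · simp [ctlnW, h, (hclique i hi j hj h).2]
  have hsum : ∀ x : Fin n → ℝ, (∀ i, i ∉ σ → x i = 0) → ∀ i,
      ∑ j, ctlnW E ε δ i j * x j = ∑ j ∈ σ, ctlnW E ε δ i j * x j := by
    intro x hx i
    symm
    apply Finset.sum_subset (Finset.subset_univ σ)
    intro j _ hj
    rw [hx j hj, mul_zero]
  have hin : ∀ x : Fin n → ℝ, ∀ i ∈ σ,
      ∑ j ∈ σ, ctlnW E ε δ i j * x j = (-1 + ε) * ∑ j ∈ σ, x j - (-1 + ε) * x i := by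
    intro x i hi
    rw [Finset.sum_congr rfl (fun j hj => hrow i hi j hj (x j)), Finset.sum_sub_distrib,
      Finset.mul_sum, Finset.sum_ite_eq, if_pos hi]
  simp only [FP, Finset.mem_filter, Finset.mem_univ, true_and]
  constructor
  · rintro ⟨x, hfix, hsupp⟩ ⟨k, hk, hkE⟩
    have hmem : ∀ i, i ∈ σ ↔ x i ≠ 0 := by
      intro i; rw [← hsupp]; simp
    have hx0 : ∀ i, i ∉ σ → x i = 0 := by
      intro i hi
      by_contra h
      exact hi ((hmem i).2 h)
    obtain ⟨i, hi⟩ := hne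
    have hipos : 0 < x i := by
      have h1 : 0 ≤ x i := by rw [hfix i]; exact le_max_left _ _
      exact lt_of_le_of_ne h1 (Ne.symm ((hmem i).1 hi))
    have h2 := hfix i
    rw [hsum x hx0, hin x i hi] at h2
    have h3 : x i = (-1 + ε) * ∑ j ∈ σ, x j - (-1 + ε) * x i + θ := by
      rcases max_choice 0 ((-1 + ε) * ∑ j ∈ σ, x j - (-1 + ε) * x i + θ) with h | h
      · rw [h] at h2; linarith
      · rw [h] at h2; exact h2
    have h4 := hfix k
    have h5 : ∑ j ∈ σ, ctlnW E ε δ k j * x j = (-1 + ε) * ∑ j ∈ σ, x j := by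
      rw [Finset.mul_sum]
      apply Finset.sum_congr rfl
      intro j hj
      have hkj : k ≠ j := fun h => hk (h ▸ hj)
      simp [ctlnW, hkj, hkE j hj]
    rw [hsum x hx0, h5, hx0 k hk] at h4
    have h6 := le_max_right 0 ((-1 + ε) * ∑ j ∈ σ, x j + θ)
    rw [← h4] at h6
    have := mul_pos hε hipos
    linarith
  · intro hT
    have hD : 0 < ε + (1 - ε) * (σ.card : ℝ) := by
      have : 0 ≤ (1 - ε) * (σ.card : ℝ) := mul_nonneg (by linarith) (Nat.cast_nonneg _)
      linarith
    obtain ⟨a, ha⟩ : ∃ a, a = θ / (ε + (1 - ε) * (σ.card : ℝ)) := ⟨_, rfl⟩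
    have hapos : 0 < a := by rw [ha]; exact div_pos hθ hD
    have haeq : a * (ε + (1 - ε) * (σ.card : ℝ)) = θ := by
      rw [ha]; exact div_mul_cancel₀ _ hD.ne'
    have hx0 : ∀ i, i ∉ σ → (fun i => if i ∈ σ then a else 0 : Fin n → ℝ) i = 0 := by
      intro i hi; simp [hi]
    have hS : ∑ j ∈ σ, (fun i => if i ∈ σ then a else 0 : Fin n → ℝ) j = σ.card * a := by
      rw [Finset.sum_congr rfl (g := fun _ => a) (fun j hj => by simp [hj])]
      simp
    refine ⟨fun i => if i ∈ σ then a else 0, ?_, ?_⟩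
    · intro i
      rw [hsum _ hx0]
      by_cases hi : i ∈ σ
      · rw [hin _ i hi, hS]
        simp only [hi, if_true]
        have : (-1 + ε) * (σ.card * a) - (-1 + ε) * a + θ = a := by
          rw [← haeq]; ring
        rw [this, max_eq_right hapos.le]
      · simp only [hi, if_false]
        symm
        apply max_eq_left
        have hex : ∃ j ∈ σ, ¬ E j i := by
          by_contra h
          push Not at h
          exact hT ⟨i, hi, h⟩
        obtain ⟨j0, hj0, hE⟩ := hex
        have hle : ∑ j ∈ σ, ctlnW E ε δ i j * (if j ∈ σ then a else 0) ≤
            ∑ j ∈ σ, ((-1 + ε) * a - (if j0 = j then (ε + δ) * a else 0)) := by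
          apply Finset.sum_le_sum
          intro j hj
          have hij : i ≠ j := fun h => hi (h ▸ hj)
          have hda := mul_pos hδ hapos
          have hea := mul_pos hε hapos
          by_cases h : j0 = j
          · subst h
            simp only [ctlnW, hij, hE, hj, if_true, if_false]
            linarith
          · by_cases h' : E j i
            · simp [ctlnW, hij, hj, h, h']
            · simp only [ctlnW, hij, hj, h, h', if_true, if_false]
              linarith
        rw [Finset.sum_sub_distrib, Finset.sum_ite_eq, if_pos hj0, Finset.sum_const,
          nsmul_eq_mul] at hle
        have hda := mul_pos hδ hapos
        linarith
    · ext i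
      by_cases hi : i ∈ σ <;> simp [hi, hapos.ne']
end

section
/- If σ is a nonempty target-free clique of G, then σ ∈ FP(G) and the corresponding fixed point is stable: every complex eigenvalue of −I + W_σ has negative real part. -/
open scoped Classical

/-- A nonempty target-free clique supports a stable fixed point. -/
theorem target_free_clique_stable_fixed_point {n : ℕ} (hn : 1 ≤ n) (E : Fin n → Fin n → Prop)
    (hirr : ∀ i, ¬ E i i) (ε δ θ : ℝ)
    (hθ : 0 < θ) (hδ : 0 < δ) (hε : 0 < ε) (hεδ : ε < δ / (δ + 1))
    (σ : Finset (Fin n)) (hne : σ.Nonempty)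
    (hclique : ∀ i ∈ σ, ∀ j ∈ σ, i ≠ j → E i j ∧ E j i)
    (htf : ¬ ∃ k, k ∉ σ ∧ ∀ i ∈ σ, E i k) :
    σ ∈ FP E ε δ θ ∧
      ∀ z ∈ spectrum ℂ
        (-(1 : Matrix σ σ ℂ) + (ctlnWSub E ε δ σ).map (fun r : ℝ => (r : ℂ))),
        z.re < 0 := by
  have hε1 : ε < 1 := by
    refine hεδ.trans ?_
    rw [div_lt_one (by linarith)]
    linarith
  have hW : ∀ i ∈ σ, ∀ j ∈ σ, ctlnW E ε δ i j = (-1 + ε) + (if i = j then 1 - ε else 0) := by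
    intro i hi j hj
    unfold ctlnW
    by_cases h : i = j
    · simp [h]
    · simp [h, (hclique i hi j hj h).2]
  have hm : (1 : ℝ) ≤ (σ.card : ℝ) := by
    exact_mod_cast hne.card_pos
  have hD : 0 < (σ.card : ℝ) * (1 - ε) + ε := by
    have : 0 ≤ (σ.card : ℝ) * (1 - ε) := mul_nonneg (by linarith) (by linarith)
    linarith
  constructor
  · obtain ⟨a, ha, haθ⟩ : ∃ a : ℝ, 0 < a ∧ ((σ.card : ℝ) * (1 - ε) + ε) * a = θ :=
      ⟨θ / ((σ.card : ℝ) * (1 - ε) + ε), div_pos hθ hD, mul_div_cancel₀ _ hD.ne'⟩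
    unfold FP
    rw [Finset.mem_filter]
    refine ⟨Finset.mem_univ _, fun i => if i ∈ σ then a else 0, ?_, ?_⟩
    · intro i
      have hs : (∑ j, ctlnW E ε δ i j * (if j ∈ σ then a else 0))
          = (∑ j ∈ σ, ctlnW E ε δ i j) * a := by
        simp [Finset.sum_mul]
      simp only [hs]
      by_cases hi : i ∈ σ
      · have h2 : (∑ j ∈ σ, ctlnW E ε δ i j) = σ.card * (-1 + ε) + (1 - ε) := by
          rw [Finset.sum_congr rfl (fun j hj => hW i hi j hj), Finset.sum_add_distrib]
          simp [hi]
          ring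
        rw [h2, if_pos hi]
        have h3 : ((σ.card : ℝ) * (-1 + ε) + (1 - ε)) * a + θ = a := by
          rw [← haθ]; ring
        rw [h3, max_eq_right ha.le]
      · rw [if_neg hi]
        have : ∃ j ∈ σ, ¬ E j i := by
          by_contra hcon
          push Not at hcon
          exact htf ⟨i, hi, hcon⟩
        obtain ⟨j0, hj0, hE⟩ := this
        have h2 : (∑ j ∈ σ, ctlnW E ε δ i j)
            ≤ ∑ j ∈ σ, ((-1 + ε) + (if j0 = j then - ε - δ else 0)) := by
          apply Finset.sum_le_sum
          intro j hj
          have hij : i ≠ j := fun h => hi (h ▸ hj)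
          unfold ctlnW
          rw [if_neg hij]
          by_cases h : j0 = j
          · subst h
            rw [if_neg hE, if_pos rfl]; linarith
          · rw [if_neg h]
            split_ifs <;> linarith
        have h3 : ∑ j ∈ σ, ((-1 + ε) + (if j0 = j then - ε - δ else 0))
            = σ.card * (-1 + ε) + (- ε - δ) := by
          rw [Finset.sum_add_distrib]
          simp [hj0]
          ring
        rw [h3] at h2
        have h4 := mul_le_mul_of_nonneg_right h2 ha.le
        have h5 : ((σ.card : ℝ) * (-1 + ε) + (- ε - δ)) * a + θ = - (δ * a) := by
          rw [← haθ]; ring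
        have h6 : 0 < δ * a := mul_pos hδ ha
        rw [max_eq_left]
        linarith
    · ext i
      simp [ha.ne']
  · intro z hz
    rw [spectrum.mem_iff, Matrix.isUnit_iff_isUnit_det, isUnit_iff_ne_zero, not_not,
      ← Matrix.exists_mulVec_eq_zero_iff] at hz
    obtain ⟨v, hv, hv0⟩ := hz
    have key : ∀ i, (z + ε) * v i + (1 - ε) * ∑ j, v j = 0 := by
      intro i
      have h := congrFun hv0 i
      rw [Matrix.sub_mulVec, Matrix.add_mulVec, Matrix.neg_mulVec, Matrix.one_mulVec,
        Algebra.algebraMap_eq_smul_one, Matrix.smul_mulVec, Matrix.one_mulVec] at h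
      have h1 : ((ctlnWSub E ε δ σ).map (fun r : ℝ => (r : ℂ))).mulVec v i
          = (-1 + ε) * ∑ j, v j + (1 - ε) * v i := by
        have h2 : ∀ j : σ, ((ctlnWSub E ε δ σ).map (fun r : ℝ => (r : ℂ))) i j * v j
            = (-1 + ε) * v j + (if i = j then (1 - ε) * v j else 0) := by
          intro j
          simp only [Matrix.map_apply, ctlnWSub, hW i.1 i.2 j.1 j.2]
          by_cases hij : i = j
          · simp [hij]
            ring
          · have : i.1 ≠ j.1 := fun h => hij (Subtype.ext h)
            simp [hij, this]
        rw [Matrix.mulVec, dotProduct, Finset.sum_congr rfl (fun j _ => h2 j),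
          Finset.sum_add_distrib, ← Finset.mul_sum]
        simp
      simp only [Pi.sub_apply, Pi.add_apply, Pi.neg_apply, Pi.smul_apply, Pi.zero_apply,
        smul_eq_mul, h1] at h
      linear_combination h
    have hsum : (z + ε + σ.card * (1 - ε)) * ∑ j, v j = 0 := by
      have h : ∑ i, ((z + ε) * v i + (1 - ε) * ∑ j, v j) = 0 :=
        Finset.sum_eq_zero (fun i _ => key i)
      rw [Finset.sum_add_distrib, ← Finset.mul_sum] at h
      simp only [Finset.sum_const, Finset.card_univ, Fintype.card_coe, nsmul_eq_mul] at h
      linear_combination h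
    rcases mul_eq_zero.1 hsum with h | h
    · have := congrArg Complex.re h
      simp at this
      linarith
    · obtain ⟨i, hi⟩ := Function.ne_iff.1 hv
      have hk := key i
      rw [h, mul_zero, add_zero] at hk
      have := congrArg Complex.re ((mul_eq_zero.1 hk).resolve_right hi)
      simp at this
      linarith
end

section
/- If G is an oriented graph (no pair of nodes i, j has edges in both directions between them) with no sinks (every node has at least one outgoing edge), then the CTLN has no stable fixed points: there is no σ ∈ FP(G) such that every complex eigenvalue of −I + W_σ has negative real part. -/
open scoped Classical

open Polynomial in
theorem aux_eval_roots {m : Type} [Fintype m] [DecidableEq m] (A : Matrix m m ℂ) (z : ℂ) :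
    (Matrix.scalar m z - A).det = (A.charpoly.roots.map (fun r => z - r)).prod := by
  rw [← Matrix.eval_charpoly]
  conv_lhs => rw [(IsAlgClosed.splits A.charpoly).eq_prod_roots_of_monic A.charpoly_monic]
  rw [Polynomial.eval_multiset_prod, Multiset.map_map]
  simp

open Polynomial in
theorem aux_trace_sq {m : Type} [Fintype m] [DecidableEq m] (A : Matrix m m ℂ) :
    (A * A).trace = (A.charpoly.roots.map (fun r => r * r)).sum := by
  have hcard : Multiset.card A.charpoly.roots = Fintype.card m := by
    rw [← (IsAlgClosed.splits A.charpoly).natDegree_eq_card_roots, A.charpoly_natDegree_eq_dim]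
  have key : (A * A).charpoly =
      ((A.charpoly.roots.map (fun r => r * r)).map (fun a => X - C a)).prod := by
    apply Polynomial.funext
    intro w
    obtain ⟨z, rfl⟩ : ∃ z : ℂ, w = z * z := IsAlgClosed.exists_eq_mul_self w
    rw [Matrix.eval_charpoly]
    have h1 : Matrix.scalar m (z * z) - A * A
        = -((Matrix.scalar m z - A) * (Matrix.scalar m (-z) - A)) := by
      have hc : Matrix.scalar m z * A = A * Matrix.scalar m z :=
        (Matrix.scalar_commute z (fun _ => mul_comm _ _) A).eq
      rw [map_mul, map_neg, sub_mul, mul_sub, mul_sub, hc]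
      noncomm_ring
    rw [h1, Matrix.det_neg, Matrix.det_mul, aux_eval_roots, aux_eval_roots, ← hcard,
      Polynomial.eval_multiset_prod, Multiset.map_map, Multiset.map_map]
    generalize A.charpoly.roots = s
    induction s using Multiset.induction_on with
    | empty => simp
    | cons a s ih =>
      simp only [Multiset.map_cons, Multiset.prod_cons, Multiset.card_cons, pow_succ,
        Function.comp, eval_sub, eval_X, eval_C] at ih ⊢
      rw [← ih]; ring
  rw [Matrix.trace_eq_sum_roots_charpoly, key, Polynomial.roots_multiset_prod_X_sub_C]

theorem aux_multiset (s : Multiset ℂ) (h : ∀ z ∈ s, z.re < 0) :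
    (s.map (fun r => r * r)).sum.re ≤ s.sum.re ^ 2 ∧ s.sum.re ≤ 0 := by
  induction s using Multiset.induction_on with
  | empty => simp
  | cons a s ih =>
    have ha := h a (by simp)
    obtain ⟨h1, h2⟩ := ih (fun z hz => h z (by simp [hz]))
    simp only [Multiset.map_cons, Multiset.sum_cons, Complex.add_re, Complex.mul_re]
    constructor
    · nlinarith [mul_nonneg_of_nonpos_of_nonpos ha.le h2, mul_self_nonneg a.im]
    · linarith

/-- stable matrices satisfy `tr (A^2) ≤ (tr A)^2`. -/
theorem aux_stable {m : Type} [Fintype m] [DecidableEq m] (A : Matrix m m ℂ)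
    (h : ∀ z ∈ spectrum ℂ A, z.re < 0) : (A * A).trace.re ≤ A.trace.re ^ 2 := by
  rw [aux_trace_sq, Matrix.trace_eq_sum_roots_charpoly]
  refine (aux_multiset _ fun z hz => h z ?_).1
  exact Matrix.mem_spectrum_of_isRoot_charpoly (Polynomial.isRoot_of_mem_roots hz)

/-- An oriented graph with no sinks yields a CTLN with no stable fixed points. -/
theorem oriented_no_sinks_no_stable_fixed_points {n : ℕ} (hn : 1 ≤ n) (E : Fin n → Fin n → Prop)
    (hirr : ∀ i, ¬ E i i) (ε δ θ : ℝ)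
    (hθ : 0 < θ) (hδ : 0 < δ) (hε : 0 < ε) (hεδ : ε < δ / (δ + 1))
    (horiented : ∀ i j, ¬ (E i j ∧ E j i))
    (hnosink : ∀ i, ∃ j, E i j) :
    ¬ ∃ σ ∈ FP E ε δ θ,
      ∀ z ∈ spectrum ℂ
        (-(1 : Matrix σ σ ℂ) + (ctlnWSub E ε δ σ).map (fun r : ℝ => (r : ℂ))),
        z.re < 0 := by
  rintro ⟨σ, hσ, hst⟩
  have hprod : 1 < (1 - ε) * (1 + δ) := by
    rw [lt_div_iff₀ (by linarith)] at hεδ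
    nlinarith
  have htr := aux_stable _ hst
  -- the real matrix
  set B : Matrix σ σ ℝ := -1 + ctlnWSub E ε δ σ with hB
  have hBm : (-(1 : Matrix σ σ ℂ) + (ctlnWSub E ε δ σ).map (fun r : ℝ => (r : ℂ)))
      = B.map (fun r : ℝ => (r : ℂ)) := by
    ext i j
    by_cases hij : i = j <;> simp [hB, Matrix.one_apply, hij]
  rw [hBm] at htr
  have hdiag : ∀ i, B i i = -1 := by
    intro i
    simp [hB, ctlnWSub, ctlnW]
  have hoff : ∀ i j, i ≠ j → 1 < B i j * B j i := by
    intro i j hij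
    have hij' : i.1 ≠ j.1 := fun h => hij (Subtype.ext h)
    have e1 : B i j = if E j.1 i.1 then -1 + ε else -1 - δ := by
      simp [hB, ctlnWSub, ctlnW, Matrix.one_apply, hij, hij']
    have e2 : B j i = if E i.1 j.1 then -1 + ε else -1 - δ := by
      simp [hB, ctlnWSub, ctlnW, Matrix.one_apply, hij.symm, hij'.symm]
    rw [e1, e2]
    have ho := horiented i.1 j.1
    split_ifs with h1 h2 h2
    · exact absurd ⟨h2, h1⟩ ho
    · nlinarith
    · nlinarith
    · nlinarith
  have hT1 : (B.map (fun r : ℝ => (r : ℂ))).trace.re = ∑ i, B i i := by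
    simp [Matrix.trace]
  have hT2 : ((B.map (fun r : ℝ => (r : ℂ))) * (B.map (fun r : ℝ => (r : ℂ)))).trace.re
      = ∑ i, ∑ j, B i j * B j i := by
    simp [Matrix.trace, Matrix.mul_apply]
  rw [hT1, hT2] at htr
  have hge : ∀ i j, 1 ≤ B i j * B j i := by
    intro i j
    by_cases hij : i = j
    · subst hij; simp [hdiag]
    · exact (hoff i j hij).le
  -- the support has at most one element
  have hsub : ∀ i j : σ, i = j := by
    intro a b
    by_contra hab
    have : ∑ i : σ, ∑ j : σ, (1 : ℝ) < ∑ i, ∑ j, B i j * B j i := by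
      apply Finset.sum_lt_sum
      · intro i _
        exact Finset.sum_le_sum fun j _ => hge i j
      · exact ⟨a, Finset.mem_univ _, Finset.sum_lt_sum (fun j _ => hge a j)
          ⟨b, Finset.mem_univ _, hoff a b hab⟩⟩
    simp only [hdiag, Finset.sum_const, nsmul_eq_mul, mul_one] at this htr
    nlinarith
  simp only [FP, Finset.mem_filter, Finset.mem_univ, true_and] at hσ
  obtain ⟨x, hx, hsupp⟩ := hσ
  have hmem : ∀ i, i ∈ σ ↔ x i ≠ 0 := by
    intro i; rw [← hsupp]; simp
  have hne : ∃ i, x i ≠ 0 := by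
    by_contra hcon
    push Not at hcon
    have := hx ⟨0, hn⟩
    simp only [hcon, mul_zero, Finset.sum_const_zero, zero_add] at this
    rw [max_eq_right hθ.le] at this
    linarith
  obtain ⟨i, hi⟩ := hne
  have hz : ∀ j, j ≠ i → x j = 0 := by
    intro j hj
    by_contra hc
    have := hsub ⟨j, (hmem j).2 hc⟩ ⟨i, (hmem i).2 hi⟩
    exact hj (congrArg Subtype.val this)
  have hs : ∀ k, ∑ j, ctlnW E ε δ k j * x j = ctlnW E ε δ k i * x i := by
    intro k
    apply Finset.sum_eq_single i
    · intro j _ hj; rw [hz j hj, mul_zero]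
    · intro h; exact absurd (Finset.mem_univ _) h
  have hxi : x i = θ := by
    have := hx i
    rw [hs i] at this
    simp only [ctlnW, if_true, zero_mul, zero_add] at this
    rw [max_eq_right hθ.le] at this
    exact this
  obtain ⟨j, hj⟩ := hnosink i
  have hji : j ≠ i := by
    rintro rfl; exact hirr _ hj
  have h1 := hx j
  rw [hs j, hz j hji, hxi] at h1
  simp only [ctlnW, if_neg hji, if_pos hj] at h1
  have h2 := le_max_right 0 ((-1 + ε) * θ + θ)
  rw [← h1] at h2
  nlinarith [mul_pos hε hθ]
end

section
/- The number of stable fixed point supports is at most 2^{n−1}; that is, the number of σ ∈ FP(G) such that every complex eigenvalue of −I + W_σ has negative real part is at most 2^{n−1}. -/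
open scoped Classical

lemma det_pos_of_stable {ι : Type} [Fintype ι] [DecidableEq ι] (B : Matrix ι ι ℝ)
    (h : ∀ z ∈ spectrum ℂ (B.map (fun r : ℝ => (r : ℂ))), z.re < 0) : 0 < (-B).det := by
  by_contra hneg
  push Not at hneg
  have h0 : B.charpoly.eval 0 = (-B).det := by
    rw [Matrix.eval_charpoly]; simp
  have hdeg : 0 < B.charpoly.degree := by
    by_contra hd
    have h1 : B.charpoly = 1 := by
      apply (Matrix.charpoly_monic B).degree_le_zero_iff_eq_one.1
      exact not_lt.1 hd
    rw [h1] at h0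
    simp at h0
    linarith
  have ht := Polynomial.tendsto_atTop_of_leadingCoeff_nonneg B.charpoly hdeg
    (by rw [(Matrix.charpoly_monic B).leadingCoeff]; norm_num)
  obtain ⟨b, hb0, hb⟩ := ((Filter.eventually_ge_atTop (0:ℝ)).and
    (ht.eventually (Filter.eventually_ge_atTop (0:ℝ)))).exists
  obtain ⟨t, ht1, ht2⟩ := intermediate_value_Icc hb0
    (f := fun t => B.charpoly.eval t) (Polynomial.continuous _).continuousOn
    (show (0:ℝ) ∈ _ from ⟨by simpa only [h0] using hneg, hb⟩)
  have hs : (t : ℂ) ∈ spectrum ℂ (B.map (fun r : ℝ => (r : ℂ))) := by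
    rw [Matrix.mem_spectrum_iff_isRoot_charpoly]
    have : (B.map (fun r : ℝ => (r : ℂ))).charpoly = B.charpoly.map Complex.ofRealHom :=
      Matrix.charpoly_map B Complex.ofRealHom
    rw [this, Polynomial.IsRoot.def]
    have h3 := Polynomial.eval_map_apply (f := Complex.ofRealHom) (p := B.charpoly) t
    simp only [Complex.ofRealHom_eq_coe] at h3
    rw [h3]
    simp only at ht2
    rw [ht2]; simp
  have := h _ hs
  simp at this
  linarith [ht1.1]

/-- Rows in `σ` from `1 - W`, other rows from the identity. -/
noncomputable def rowM {n : ℕ} (W : Matrix (Fin n) (Fin n) ℝ) (σ : Finset (Fin n)) :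
    Matrix (Fin n) (Fin n) ℝ :=
  fun i j => if i ∈ σ then (1 - W) i j else (1 : Matrix (Fin n) (Fin n) ℝ) i j

lemma rowM_det {n : ℕ} (W : Matrix (Fin n) (Fin n) ℝ) (σ : Finset (Fin n)) :
    (rowM W σ).det = (Matrix.of fun i j : σ => (1 - W) i.1 j.1).det := by
  rw [Matrix.twoBlockTriangular_det (rowM W σ) (fun i => i ∈ σ)]
  · have h2 : Matrix.toSquareBlockProp (rowM W σ) (fun i => ¬ i ∈ σ) = 1 := by
      ext i j
      simp only [Matrix.toSquareBlockProp_def, Matrix.of_apply, rowM, if_neg i.2, Matrix.one_apply,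
        Subtype.ext_iff]
    rw [h2, Matrix.det_one, mul_one]
    have h1 : Matrix.toSquareBlockProp (rowM W σ) (fun i => i ∈ σ)
        = (Matrix.of fun i j : σ => (1 - W) i.1 j.1) := by
      ext i j
      have := i.2
      simp only [Matrix.toSquareBlockProp_def, Matrix.of_apply, rowM]
      exact if_pos this
    convert congrArg Matrix.det h1
  · intro i hi j hj
    simp only [rowM, if_neg hi]
    exact Matrix.one_apply_ne (fun h => hi (h ▸ hj))

lemma key {n : ℕ} (E : Fin n → Fin n → Prop) (ε δ θ : ℝ) (σ : Finset (Fin n)) (v : Fin n)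
    (hv : v ∉ σ) (hσ : σ ∈ FP E ε δ θ) (hτ : insert v σ ∈ FP E ε δ θ)
    (d1 : 0 < (rowM (ctlnW E ε δ) σ).det) (d2 : 0 < (rowM (ctlnW E ε δ) (insert v σ)).det) :
    False := by
  simp only [FP, Finset.mem_filter, Finset.mem_univ, true_and] at hσ hτ
  obtain ⟨y, hy, hys⟩ := hσ
  obtain ⟨x, hx, hxs⟩ := hτ
  have hym : ∀ i, i ∈ σ ↔ y i ≠ 0 := fun i => by rw [← hys]; simp
  have hxm : ∀ i, i ∈ insert v σ ↔ x i ≠ 0 := fun i => by rw [← hxs]; simp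
  set W := ctlnW E ε δ with hW
  have eqn : ∀ z : Fin n → ℝ, IsCTLNFixedPoint E ε δ θ z → ∀ i, z i ≠ 0 →
      0 < z i ∧ z i = (∑ j, W i j * z j) + θ := by
    intro z hz i hi
    have := hz i
    rcases max_choice 0 ((∑ j, ctlnW E ε δ i j * z j) + θ) with h | h
    · rw [h] at this; exact absurd this hi
    · have h' := le_max_left 0 ((∑ j, ctlnW E ε δ i j * z j) + θ)
      rw [← this] at h'
      exact ⟨lt_of_le_of_ne h' (Ne.symm hi), by rw [h] at this; exact this⟩
  have hmul : ∀ z : Fin n → ℝ, ∀ i, ((1 - W).mulVec z) i = z i - ∑ j, W i j * z j := by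
    intro z i
    rw [Matrix.sub_mulVec, Matrix.one_mulVec]; rfl
  have hyv : y v = 0 := by
    by_contra h; exact hv ((hym v).2 h)
  have hyv2 : (∑ j, W v j * y j) + θ ≤ 0 := by
    have := hy v
    rw [hyv] at this
    rw [this]; exact le_max_right _ _
  have hrow : ∀ z : Fin n → ℝ, ∀ i, ((rowM W (insert v σ)).mulVec z) i =
      if i ∈ insert v σ then z i - ∑ j, W i j * z j else z i := by
    intro z i
    split_ifs with h
    · rw [← hmul]; simp only [Matrix.mulVec, dotProduct, rowM, if_pos h]
    · conv_rhs => rw [← Matrix.one_mulVec z]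
      simp only [Matrix.mulVec, dotProduct, rowM, if_neg h]
  set c := -((∑ j, W v j * y j) + θ) with hc
  have hMw : (rowM W (insert v σ)).mulVec (y - x) = Pi.single v c := by
    rw [Matrix.mulVec_sub]
    ext i
    rw [Pi.sub_apply, hrow, hrow]
    by_cases hiv : i = v
    · subst hiv
      have hi := Finset.mem_insert_self i σ
      have := (eqn x hx i ((hxm i).1 hi)).2
      simp only [if_pos hi, Pi.single_eq_same]
      rw [hc, hyv]; linarith
    · rw [Pi.single_eq_of_ne hiv]
      by_cases hi : i ∈ σ
      · have hi' := Finset.mem_insert_of_mem (b := v) hi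
        have h1 := (eqn x hx i ((hxm i).1 hi')).2
        have h2 := (eqn y hy i ((hym i).1 hi)).2
        simp only [if_pos hi']; linarith
      · have hi' : i ∉ insert v σ := by simp [hiv, hi]
        have h1 : x i = 0 := by by_contra h; exact hi' ((hxm i).2 h)
        have h2 : y i = 0 := by by_contra h; exact hi ((hym i).2 h)
        simp only [if_neg hi', h1, h2, sub_zero]
  have hadj : (rowM W (insert v σ)).adjugate v v = (rowM W σ).det := by
    rw [Matrix.adjugate_apply]
    congr 1
    ext i j
    by_cases hiv : i = v
    · subst hiv
      simp [rowM, hv, Matrix.one_apply, Pi.single_apply, eq_comm]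
    · simp [rowM, Matrix.updateRow_ne hiv, hiv]
  have hfin := congrArg (fun u => ((rowM W (insert v σ)).adjugate.mulVec u) v) hMw
  simp only [Matrix.mulVec_mulVec, Matrix.adjugate_mul, Matrix.smul_mulVec, Matrix.one_mulVec,
    Matrix.mulVec_single, Pi.smul_apply, Pi.sub_apply, smul_eq_mul, hyv, Matrix.col_apply,
    hadj, MulOpposite.smul_eq_mul_unop, MulOpposite.unop_op] at hfin
  have hxv := (eqn x hx v ((hxm v).1 (Finset.mem_insert_self v σ))).1
  have hc0 : 0 ≤ c := by rw [hc]; linarith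
  have := mul_pos d2 hxv
  have := mul_nonneg d1.le hc0
  linarith

lemma stable_det {n : ℕ} (E : Fin n → Fin n → Prop) (ε δ : ℝ) (σ : Finset (Fin n))
    (h : ∀ z ∈ spectrum ℂ
          (-(1 : Matrix σ σ ℂ) + (ctlnWSub E ε δ σ).map (fun r : ℝ => (r : ℂ))),
          z.re < 0) : 0 < (rowM (ctlnW E ε δ) σ).det := by
  rw [rowM_det]
  have := det_pos_of_stable (-1 + ctlnWSub E ε δ σ) (by
    convert h using 4
    ext i j
    by_cases hij : i = j <;> simp [Matrix.one_apply, hij])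
  convert this using 2
  ext i j
  by_cases hij : i = j
  · subst hij; simp [ctlnWSub]; ring
  · have : i.1 ≠ j.1 := fun h => hij (Subtype.ext h)
    simp [ctlnWSub, Matrix.one_apply, hij, this]

/-- The number of stable fixed point supports is at most `2^(n-1)`. -/
theorem stable_FP_card_le {n : ℕ} (hn : 1 ≤ n) (E : Fin n → Fin n → Prop)
    (hirr : ∀ i, ¬ E i i) (ε δ θ : ℝ)
    (hθ : 0 < θ) (hδ : 0 < δ) (hε : 0 < ε) (hεδ : ε < δ / (δ + 1)) :
    ((FP E ε δ θ).filter fun σ : Finset (Fin n) =>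
        ∀ z ∈ spectrum ℂ
          (-(1 : Matrix σ σ ℂ) + (ctlnWSub E ε δ σ).map (fun r : ℝ => (r : ℂ))),
          z.re < 0).card ≤ 2 ^ (n - 1) := by
  let v : Fin n := ⟨0, hn⟩
  have hcard : ((Finset.univ.erase v).powerset).card = 2 ^ (n - 1) := by
    rw [Finset.card_powerset, Finset.card_erase_of_mem (Finset.mem_univ v)]; simp
  rw [← hcard]
  apply Finset.card_le_card_of_injOn (fun σ => σ.erase v)
  · intro σ _
    simp only [Finset.coe_powerset, Set.mem_preimage, Set.mem_powerset_iff, Finset.coe_subset]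
    exact Finset.erase_subset_erase _ (Finset.subset_univ _)
  · intro σ hσ τ hτ hst
    simp only [Finset.coe_filter, Set.mem_setOf_eq] at hσ hτ
    have d1 := stable_det E ε δ σ hσ.2
    have d2 := stable_det E ε δ τ hτ.2
    simp only at hst
    by_cases h1 : v ∈ σ <;> by_cases h2 : v ∈ τ
    · rw [← Finset.insert_erase h1, hst, Finset.insert_erase h2]
    · rw [Finset.erase_eq_of_notMem h2] at hst
      have he : insert v τ = σ := by rw [← hst, Finset.insert_erase h1]
      exact (key E ε δ θ τ v h2 hτ.1 (he ▸ hσ.1) d2 (by rw [he]; exact d1)).elim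
    · rw [Finset.erase_eq_of_notMem h1] at hst
      have he : insert v σ = τ := by rw [hst, Finset.insert_erase h2]
      exact (key E ε δ θ σ v h1 hσ.1 (he ▸ hτ.1) d1 (by rw [he]; exact d2)).elim
    · rwa [Finset.erase_eq_of_notMem h1, Finset.erase_eq_of_notMem h2] at hst
end

section
/- For any node i ∈ [n], the singleton {i} belongs to FP(G) if and only if i is a sink in G (i has no outgoing edges). -/
open scoped Classical

/-- A singleton `{i}` is in `FP(G)` iff `i` is a sink. -/
theorem singleton_mem_FP_iff_sink {n : ℕ} (hn : 1 ≤ n) (E : Fin n → Fin n → Prop)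
    (hirr : ∀ i, ¬ E i i) (ε δ θ : ℝ)
    (hθ : 0 < θ) (hδ : 0 < δ) (hε : 0 < ε) (hεδ : ε < δ / (δ + 1)) (i : Fin n) :
    {i} ∈ FP E ε δ θ ↔ ∀ j, ¬ E i j := by
  unfold FP
  simp only [Finset.mem_filter, Finset.mem_univ, true_and]
  constructor
  · rintro ⟨x, hx, hs⟩ j hij
    have hne : j ≠ i := by
      rintro rfl
      exact hirr _ hij
    have h0 : ∀ k, k ≠ i → x k = 0 := by
      intro k hk
      by_contra h
      have : k ∈ (Finset.univ.filter fun i => x i ≠ 0) := by simp [h]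
      rw [hs] at this
      exact hk (by simpa using this)
    have hsum : ∀ k, ∑ l, ctlnW E ε δ k l * x l = ctlnW E ε δ k i * x i := by
      intro k
      apply Finset.sum_eq_single i
      · intro l _ hl
        rw [h0 l hl, mul_zero]
      · simp
    have h1 := hx i
    have h2 := hx j
    rw [hsum] at h1 h2
    simp only [ctlnW, if_true, zero_mul, zero_add] at h1
    rw [max_eq_right hθ.le] at h1
    simp only [ctlnW, if_neg hne, if_pos hij] at h2
    rw [h0 j hne, h1] at h2
    have h3 := le_max_right 0 ((-1 + ε) * θ + θ)
    rw [← h2] at h3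
    nlinarith [mul_pos hε hθ]
  · intro h
    refine ⟨fun k => if k = i then θ else 0, ?_, ?_⟩
    · intro k
      have hsum : ∑ l, ctlnW E ε δ k l * (if l = i then θ else 0) = ctlnW E ε δ k i * θ := by
        simp
      simp only [hsum]
      by_cases hk : k = i
      · subst hk
        simp [ctlnW, hθ.le]
      · simp only [ctlnW, if_neg hk, if_neg (h k)]
        rw [max_eq_left]
        nlinarith [mul_pos hδ hθ]
    · ext k
      simp [hθ.ne']
end

section
/- Let σ ⊆ [n] be a nonempty independent set of G (there are no edges between any pair of distinct nodes of σ). Then σ ∈ FP(G) if and only if every node of σ is a sink in G (has no outgoing edges in G). -/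
open scoped Classical

/-- A nonempty independent set is in `FP(G)` iff every one of its nodes is a sink. -/
theorem independent_set_mem_FP_iff_sinks {n : ℕ} (hn : 1 ≤ n) (E : Fin n → Fin n → Prop)
    (hirr : ∀ i, ¬ E i i) (ε δ θ : ℝ)
    (hθ : 0 < θ) (hδ : 0 < δ) (hε : 0 < ε) (hεδ : ε < δ / (δ + 1))
    (σ : Finset (Fin n)) (hne : σ.Nonempty)
    (hind : ∀ i ∈ σ, ∀ j ∈ σ, ¬ E i j) :
    σ ∈ FP E ε δ θ ↔ ∀ i ∈ σ, ∀ j, ¬ E i j := by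
  constructor
  · intro h i hi k hik
    simp only [FP, Finset.mem_filter, Finset.mem_univ, true_and] at h
    obtain ⟨x, hx, hs⟩ := h
    have hmem : ∀ j, j ∈ σ ↔ x j ≠ 0 := by
      intro j
      rw [← hs]; simp
    have hnn : ∀ j, 0 ≤ x j := fun j => by rw [hx j]; exact le_max_left _ _
    have hk : k ∉ σ := fun hk => hind i hi k hk hik
    have hxk : x k = 0 := by
      by_contra h0
      exact hk ((hmem k).2 h0)
    have hxi : 0 < x i := lt_of_le_of_ne (hnn i) (Ne.symm ((hmem i).1 hi))
    have e1 : x i = (∑ j, ctlnW E ε δ i j * x j) + θ := by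
      have h1 := hx i
      rcases max_choice 0 ((∑ j, ctlnW E ε δ i j * x j) + θ) with h2 | h2
      · rw [h2] at h1; linarith
      · rw [h2] at h1; exact h1
    have e2 : (∑ j, ctlnW E ε δ k j * x j) + θ ≤ 0 := by
      have h1 := hx k
      rw [hxk] at h1
      rw [h1]; exact le_max_right _ _
    have e3 : ∑ j, (ctlnW E ε δ i j * x j + (if i = j then (-1 + ε) * x i else 0))
        ≤ ∑ j, ctlnW E ε δ k j * x j := by
      apply Finset.sum_le_sum
      intro j _
      by_cases hj : j ∈ σ
      · have hkj : k ≠ j := fun h => hk (h ▸ hj)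
        by_cases hij : i = j
        · subst hij
          simp [ctlnW, hkj, hik]
        · have hE := hind j hj i hi
          simp only [ctlnW, hkj, hij, hE, if_false, add_zero]
          apply mul_le_mul_of_nonneg_right _ (hnn j)
          split_ifs <;> linarith
      · have h0 : x j = 0 := by
          by_contra h0
          exact hj ((hmem j).2 h0)
        have hij : i ≠ j := fun h => hj (h ▸ hi)
        simp [h0, hij]
    rw [Finset.sum_add_distrib, Finset.sum_ite_eq] at e3
    simp only [Finset.mem_univ, if_true] at e3
    nlinarith [mul_pos hε hxi]
  · intro h
    simp only [FP, Finset.mem_filter, Finset.mem_univ, true_and]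
    have hm : (1 : ℝ) ≤ (σ.card : ℝ) := by exact_mod_cast hne.card_pos
    have hD : 0 < (σ.card : ℝ) + δ * ((σ.card : ℝ) - 1) := by
      have := mul_nonneg hδ.le (sub_nonneg.2 hm)
      linarith
    obtain ⟨a, ha⟩ : ∃ a, a = θ / ((σ.card : ℝ) + δ * ((σ.card : ℝ) - 1)) := ⟨_, rfl⟩
    have ha0 : 0 < a := ha ▸ div_pos hθ hD
    have hθa : θ = a * ((σ.card : ℝ) + δ * ((σ.card : ℝ) - 1)) := by
      rw [ha]; field_simp
    refine ⟨fun i => if i ∈ σ then a else 0, ?_, ?_⟩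
    · intro i
      have e : ∑ j, ctlnW E ε δ i j * (if j ∈ σ then a else 0) =
          ∑ j, ((if j ∈ σ then -(1 + δ) * a else 0) +
            (if i = j then (if i ∈ σ then (1 + δ) * a else 0) else 0)) := by
        apply Finset.sum_congr rfl
        intro j _
        by_cases hj : j ∈ σ
        · by_cases hij : i = j
          · subst hij
            simp [ctlnW, hj]
            ring
          · simp only [ctlnW, hj, hij, h j hj i, if_true, if_false]
            ring
        · by_cases hij : i = j
          · subst hij
            simp [hj]
          · simp [hj, hij]
      rw [e, Finset.sum_add_distrib, Finset.sum_ite_eq, Finset.sum_ite_mem]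
      simp only [Finset.mem_univ, if_true, Finset.univ_inter, Finset.sum_const, nsmul_eq_mul]
      by_cases hi : i ∈ σ
      · simp only [hi, if_true]
        rw [max_eq_right] <;> nlinarith
      · simp only [hi, if_false]
        rw [max_eq_left]
        nlinarith [mul_pos hδ ha0]
    · ext i
      simp [ha0.ne']
end

section
/- If σ ⊆ [n] contains a node i that is a proper source in the induced subgraph G|σ (i receives no edges from σ∖{i} but sends at least one edge to a node of σ∖{i}), then σ ∉ FP(G). -/
open scoped Classical

/-- If some `i ∈ σ` is a proper source in `G|_σ`, then `σ ∉ FP(G)`. -/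
theorem proper_source_in_restriction_not_mem_FP {n : ℕ} (hn : 1 ≤ n) (E : Fin n → Fin n → Prop)
    (hirr : ∀ i, ¬ E i i) (ε δ θ : ℝ)
    (hθ : 0 < θ) (hδ : 0 < δ) (hε : 0 < ε) (hεδ : ε < δ / (δ + 1))
    (σ : Finset (Fin n)) (i : Fin n) (hi : i ∈ σ)
    (hrec : ∀ j ∈ σ, j ≠ i → ¬ E j i)
    (hsend : ∃ j ∈ σ, j ≠ i ∧ E i j) :
    σ ∉ FP E ε δ θ := by
  intro hmem
  simp only [FP, Finset.mem_filter, Finset.mem_univ, true_and] at hmem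
  obtain ⟨x, hx, hσ⟩ := hmem
  obtain ⟨j, hj, hji, hEij⟩ := hsend
  have hsup : ∀ k, k ∈ σ ↔ x k ≠ 0 := by
    intro k
    rw [← hσ]
    simp
  have hnn : ∀ k, 0 ≤ x k := by
    intro k
    rw [hx k]
    exact le_max_left _ _
  have hpos : ∀ k ∈ σ, 0 < x k := fun k hk =>
    lt_of_le_of_ne (hnn k) (Ne.symm ((hsup k).1 hk))
  have heq : ∀ k ∈ σ, x k = (∑ l, ctlnW E ε δ k l * x l) + θ := by
    intro k hk
    have h1 := hx k
    have h2 := hpos k hk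
    rcases max_cases 0 ((∑ l, ctlnW E ε δ k l * x l) + θ) with h | h
    · rw [h.1] at h1
      linarith
    · rw [h.1] at h1
      exact h1
  have hle : ∑ k, (ctlnW E ε δ i k * x k + ((if k = i then (-1 + ε) * x i else 0)
      + (if k = j then (1 + δ) * x j else 0))) ≤ ∑ k, ctlnW E ε δ j k * x k := by
    apply Finset.sum_le_sum
    intro k _
    by_cases hki : k = i
    · subst hki
      simp [ctlnW, hji, hEij, Ne.symm hji]
    · by_cases hkj : k = j
      · subst hkj
        simp only [ctlnW, if_neg hki, if_neg (Ne.symm hki), if_neg (hrec k hj hki), if_true]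
        linarith
      · simp only [ctlnW, if_neg hki, if_neg hkj, if_neg (Ne.symm hki), if_neg (Ne.symm hkj)]
        by_cases hk : k ∈ σ
        · have := hpos k hk
          rw [if_neg (hrec k hk hki)]
          split_ifs <;> nlinarith
        · have : x k = 0 := by
            by_contra h
            exact hk ((hsup k).2 h)
          simp [this]
  rw [Finset.sum_add_distrib, Finset.sum_add_distrib, Finset.sum_ite_eq', Finset.sum_ite_eq',
    if_pos (Finset.mem_univ _), if_pos (Finset.mem_univ _)] at hle
  have h1 := heq i hi
  have h2 := heq j hj
  have h3 := mul_pos hε (hpos i hi)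
  have h4 := mul_pos hδ (hpos j hj)
  nlinarith
end

section
/- If i ∈ [n] is a proper source in G (i receives no edges but sends at least one edge), then FP(G) = FP(G∖{i}); that is, for every σ ⊆ [n], σ ∈ FP(G) if and only if i ∉ σ and σ ∈ FP(G|_{[n]∖{i}}). -/
open scoped Classical

theorem aux_source {V : Type} [Fintype V] (E : V → V → Prop) (ε δ : ℝ) (x : V → ℝ) (i : V)
    (hrec : ∀ j, ¬ E j i) :
    ∑ j, ctlnW E ε δ i j * x j = -(1 + δ) * (∑ j, x j - x i) := by
  have h : ∀ j, ctlnW E ε δ i j * x j = -(1 + δ) * x j + (if j = i then (1 + δ) * x j else 0) := by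
    intro j
    by_cases h1 : j = i
    · subst h1
      simp [ctlnW]
      ring
    · simp only [ctlnW, h1, Ne.symm h1, hrec, if_false]
      ring
  rw [Finset.sum_congr rfl (fun j _ => h j), Finset.sum_add_distrib, ← Finset.mul_sum]
  simp
  ring

theorem aux_target {V : Type} [Fintype V] (E : V → V → Prop) (ε δ : ℝ) (x : V → ℝ) (i k : V)
    (hδ : 0 < δ) (hε : 0 < ε) (hx : ∀ j, 0 ≤ x j) (hik : i ≠ k) (hE : E i k) :
    -(1 + δ) * (∑ j, x j - x k) + (ε + δ) * x i ≤ ∑ j, ctlnW E ε δ k j * x j := by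
  have h : ∀ j, -(1 + δ) * x j + (if j = k then (1 + δ) * x j else 0)
      + (if j = i then (ε + δ) * x j else 0) ≤ ctlnW E ε δ k j * x j := by
    intro j
    have hj := hx j
    have h3 := mul_nonneg hδ.le hj
    have h4 := mul_nonneg hε.le hj
    by_cases h1 : j = k
    · subst h1
      simp [ctlnW, Ne.symm hik]
      linarith
    · by_cases h2 : j = i
      · subst h2
        simp [ctlnW, h1, Ne.symm h1, hE]
        linarith
      · simp only [ctlnW, h1, Ne.symm h1, h2, if_false]
        split_ifs <;> linarith
  have := Finset.sum_le_sum (fun j (_ : j ∈ Finset.univ) => h j)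
  rw [Finset.sum_add_distrib, Finset.sum_add_distrib, ← Finset.mul_sum] at this
  simp at this
  linarith

theorem aux_sub {n : ℕ} (E : Fin n → Fin n → Prop) (ε δ : ℝ) (x : Fin n → ℝ) (i : Fin n)
    (hx : x i = 0) (a : {x : Fin n // x ≠ i}) :
    ∑ j, ctlnW (fun a b : {x : Fin n // x ≠ i} => E a.1 b.1) ε δ a j * x j.1
      = ∑ j, ctlnW E ε δ a.1 j * x j := by
  rw [Fintype.sum_eq_add_sum_subtype_ne _ i, hx, mul_zero, zero_add]
  refine Finset.sum_congr rfl fun j _ => ?_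
  simp [ctlnW, Subtype.ext_iff]

/-- If `i` is a proper source in `G`, then `FP(G) = FP(G \ {i})`. -/
theorem proper_source_FP_eq {n : ℕ} (hn : 1 ≤ n) (E : Fin n → Fin n → Prop)
    (hirr : ∀ i, ¬ E i i) (ε δ θ : ℝ)
    (hθ : 0 < θ) (hδ : 0 < δ) (hε : 0 < ε) (hεδ : ε < δ / (δ + 1))
    (i : Fin n) (hrec : ∀ j, ¬ E j i) (hsend : ∃ j, E i j) :
    ∀ σ : Finset (Fin n),
      σ ∈ FP E ε δ θ ↔
        (i ∉ σ ∧
          σ.subtype (· ≠ i) ∈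
            FP (fun a b : {x : Fin n // x ≠ i} => E a.1 b.1) ε δ θ) := by
  intro σ
  obtain ⟨k, hk⟩ := hsend
  have hik : i ≠ k := by
    rintro rfl
    exact hirr _ hk
  simp only [FP, Finset.mem_filter, Finset.mem_univ, true_and]
  constructor
  · rintro ⟨x, hx, rfl⟩
    have hpos : ∀ j, 0 ≤ x j := fun j => by rw [hx j]; exact le_max_left _ _
    have hxi : x i = 0 := by
      by_contra hne
      have hp : 0 < x i := lt_of_le_of_ne (hpos i) (Ne.symm hne)
      have h1 := hx i
      rw [aux_source E ε δ x i hrec] at h1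
      have h2 : x i = -(1 + δ) * (∑ j, x j - x i) + θ := by
        rcases max_choice 0 (-(1 + δ) * (∑ j, x j - x i) + θ) with h | h
        · rw [h] at h1
          exact absurd h1 hne
        · rw [h] at h1
          exact h1
      have h3 := aux_target E ε δ x i k hδ hε hpos hik hk
      have h4 : (∑ j, ctlnW E ε δ k j * x j) + θ ≤ x k := by
        conv_rhs => rw [hx k]
        exact le_max_right _ _
      nlinarith [mul_pos hε hp, mul_nonneg hδ.le (hpos k)]
    refine ⟨by simp [hxi], fun a => x a.1, ?_, ?_⟩
    · intro a
      simp only []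
      rw [aux_sub E ε δ x i hxi a]
      exact hx a.1
    · ext a
      simp
  · rintro ⟨hi, y, hy, hs⟩
    let x : Fin n → ℝ := fun j => if h : j ≠ i then y ⟨j, h⟩ else 0
    have hxi : x i = 0 := by simp [x]
    have hxa : ∀ a : {x : Fin n // x ≠ i}, x a.1 = y a := fun a => by simp [x, a.2]
    have hy' : ∀ a : {x : Fin n // x ≠ i},
        x a.1 = max 0 ((∑ j, ctlnW E ε δ a.1 j * x j) + θ) := by
      intro a
      rw [← aux_sub E ε δ x i hxi a]
      simp only [hxa]
      exact hy a
    have hpos : ∀ j, 0 ≤ x j := by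
      intro j
      by_cases h : j = i
      · rw [h, hxi]
      · rw [hy' ⟨j, h⟩]
        exact le_max_left _ _
    refine ⟨x, ?_, ?_⟩
    · intro j
      by_cases h : j = i
      · subst h
        rw [aux_source E ε δ x j hrec, hxi]
        have h3 := aux_target E ε δ x j k hδ hε hpos hik hk
        have h4 : (∑ l, ctlnW E ε δ k l * x l) + θ ≤ x k := by
          conv_rhs => rw [hy' ⟨k, Ne.symm hik⟩]
          exact le_max_right _ _
        rw [hxi] at h3
        rw [max_eq_left]
        nlinarith [mul_nonneg hδ.le (hpos k)]
      · exact hy' ⟨j, h⟩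
    · ext j
      by_cases h : j = i
      · subst h
        simp [hxi, hi]
      · have := Finset.ext_iff.1 hs ⟨j, h⟩
        simp only [Finset.mem_filter, Finset.mem_univ, true_and, Finset.mem_subtype] at this ⊢
        rw [← this, ← hxa]
end

section
/- (Inside-in domination) Suppose j, k ∈ σ are distinct nodes and k dominates j with respect to σ. Then σ ∉ FP(G|σ), and consequently σ ∉ FP(G). -/
open scoped Classical

/-- `k` dominates `j` with respect to `σ`. -/
def Dominates {V : Type} (E : V → V → Prop) (σ : Finset V) (k j : V) : Prop :=
  (j ∈ σ ∨ k ∈ σ) ∧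
  (∀ i ∈ σ, i ≠ j → i ≠ k → E i j → E i k) ∧
  (j ∈ σ → E j k) ∧
  (k ∈ σ → ¬ E k j)

theorem inside_in_aux {V : Type} [Fintype V] (E : V → V → Prop) (ε δ θ : ℝ)
    (hδ : 0 < δ) (hε : 0 < ε) (σ : Finset V) (j k : V) (hjk : j ≠ k)
    (hj : j ∈ σ) (hk : k ∈ σ) (hdom : Dominates E σ k j) : σ ∉ FP E ε δ θ := by
  intro h
  obtain ⟨x, hx, hs⟩ := (Finset.mem_filter.mp h).2
  have hmem : ∀ i, i ∈ σ ↔ x i ≠ 0 := by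
    intro i
    rw [← hs]
    simp
  have hnn : ∀ i, 0 ≤ x i := fun i => by rw [hx i]; exact le_max_left _ _
  have hpos : ∀ i ∈ σ, 0 < x i := fun i hi =>
    lt_of_le_of_ne (hnn i) (Ne.symm ((hmem i).1 hi))
  have heq : ∀ i ∈ σ, x i = (∑ l, ctlnW E ε δ i l * x l) + θ := by
    intro i hi
    have h1 := hx i
    have h2 := hpos i hi
    rcases max_choice 0 ((∑ l, ctlnW E ε δ i l * x l) + θ) with h3 | h3
    · rw [h3] at h1
      linarith
    · rw [h3] at h1
      exact h1
  obtain ⟨-, h1, h2, h3⟩ := hdom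
  have hjk' := h2 hj
  have hkj' := h3 hk
  have key : ∑ l, ctlnW E ε δ j l * x l ≤ ∑ l, (ctlnW E ε δ k l * x l +
      ((if l = j then (1 - ε) * x j else 0) + (if l = k then -(1 + δ) * x k else 0))) := by
    apply Finset.sum_le_sum
    intro l _
    by_cases hlj : l = j
    · subst hlj
      simp only [ctlnW, if_true, if_neg hjk, if_neg hjk.symm, if_pos hjk']
      linarith
    by_cases hlk : l = k
    · subst hlk
      simp only [ctlnW, if_true, if_neg hjk, if_neg hjk.symm, if_neg hkj']
      linarith
    rw [if_neg hlj, if_neg hlk, add_zero, add_zero]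
    by_cases hl : l ∈ σ
    · apply mul_le_mul_of_nonneg_right _ (hnn l)
      have h4 := h1 l hl hlj hlk
      simp only [ctlnW, if_neg (Ne.symm hlj), if_neg (Ne.symm hlk)]
      by_cases h5 : E l j
      · simp [h5, h4 h5]
      · rw [if_neg h5]
        split_ifs <;> linarith
    · have : x l = 0 := by
        by_contra h6
        exact hl ((hmem l).2 h6)
      simp [this]
  rw [Finset.sum_add_distrib, Finset.sum_add_distrib, Finset.sum_ite_eq' Finset.univ j,
    Finset.sum_ite_eq' Finset.univ k, if_pos (Finset.mem_univ _), if_pos (Finset.mem_univ _)] at key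
  have e1 := heq j hj
  have e2 := heq k hk
  have p1 := mul_pos hε (hpos j hj)
  have p2 := mul_pos hδ (hpos k hk)
  linarith

/-- Inside-in domination: if `j, k ∈ σ` and `k` dominates `j` w.r.t. `σ`,
then `σ ∉ FP(G|_σ)` and `σ ∉ FP(G)`. -/
theorem domination_inside_in {n : ℕ} (hn : 1 ≤ n) (E : Fin n → Fin n → Prop)
    (hirr : ∀ i, ¬ E i i) (ε δ θ : ℝ)
    (hθ : 0 < θ) (hδ : 0 < δ) (hε : 0 < ε) (hεδ : ε < δ / (δ + 1))
    (σ : Finset (Fin n)) (j k : Fin n) (hjk : j ≠ k)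
    (hj : j ∈ σ) (hk : k ∈ σ) (hdom : Dominates E σ k j) :
    σ.subtype (· ∈ σ) ∉ FP (fun a b : {x // x ∈ σ} => E a.1 b.1) ε δ θ ∧
    σ ∉ FP E ε δ θ := by
  refine ⟨?_, inside_in_aux E ε δ θ hδ hε σ j k hjk hj hk hdom⟩
  obtain ⟨-, h1, h2, h3⟩ := hdom
  refine inside_in_aux _ ε δ θ hδ hε _ ⟨j, hj⟩ ⟨k, hk⟩ (fun h => hjk (congrArg Subtype.val h))
    (by simpa using hj) (by simpa using hk) ⟨Or.inl (by simpa using hj), ?_, ?_, ?_⟩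
  · intro i _ hij hik h
    exact h1 i.1 i.2 (fun h => hij (Subtype.ext h)) (fun h => hik (Subtype.ext h)) h
  · intro _
    exact h2 hj
  · intro _
    exact h3 hk
end

section
/- (Outside-in domination) Suppose j ∈ σ, k ∉ σ, and k dominates j with respect to σ. Then σ ∉ FP(G|_{σ∪{k}}), and consequently σ ∉ FP(G). -/
open scoped Classical

theorem dom_aux {V : Type} [Fintype V] (E : V → V → Prop) (ε δ θ : ℝ)
    (hδ : 0 < δ) (hε : 0 < ε)
    (σ : Finset V) (j k : V) (hjk : j ≠ k)
    (hj : j ∈ σ) (hk : k ∉ σ) (hdom : Dominates E σ k j) : σ ∉ FP E ε δ θ := by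
  intro h
  obtain ⟨x, hx, hs⟩ := (Finset.mem_filter.mp h).2
  have hmem : ∀ i, i ∈ σ ↔ x i ≠ 0 := by
    intro i
    rw [← hs]
    simp
  obtain ⟨-, h1, h2, -⟩ := hdom
  have hnn : ∀ i, 0 ≤ x i := fun i => by
    rw [hx i]
    exact le_max_left _ _
  have hxj : 0 < x j := lt_of_le_of_ne (hnn j) (Ne.symm ((hmem j).1 hj))
  have hxk : x k = 0 := by
    by_contra hne
    exact hk ((hmem k).2 hne)
  have ej : x j = (∑ i, ctlnW E ε δ j i * x i) + θ := by
    rcases max_choice 0 ((∑ i, ctlnW E ε δ j i * x i) + θ) with h0 | h0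
    · have := hx j
      rw [h0] at this
      linarith
    · exact (hx j).trans h0
  have ek : (∑ i, ctlnW E ε δ k i * x i) + θ ≤ 0 := by
    have := hx k
    rw [hxk] at this
    rw [this]
    exact le_max_right _ _
  have key : ∑ i, (ctlnW E ε δ j i * x i + if i = j then (-1 + ε) * x j else 0)
      ≤ ∑ i, ctlnW E ε δ k i * x i := by
    apply Finset.sum_le_sum
    intro i _
    by_cases hij : i = j
    · subst hij
      simp [ctlnW, hjk.symm, h2 hj]
    · by_cases hi : i ∈ σ
      · have hik : i ≠ k := fun e => hk (e ▸ hi)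
        have h3 := h1 i hi hij hik
        have h4 := hnn i
        have hW : ctlnW E ε δ j i ≤ ctlnW E ε δ k i := by
          simp only [ctlnW, if_neg (Ne.symm hij), if_neg (Ne.symm hik)]
          split_ifs <;> first | linarith | (exfalso; tauto)
        simpa [hij] using mul_le_mul_of_nonneg_right hW h4
      · have : x i = 0 := by
          by_contra hne
          exact hi ((hmem i).2 hne)
        simp [this, hij]
  rw [Finset.sum_add_distrib, Finset.sum_ite_eq' Finset.univ j] at key
  simp only [Finset.mem_univ, if_true] at key
  nlinarith [mul_pos hε hxj]

/-- Outside-in domination: if `j ∈ σ`, `k ∉ σ` and `k` dominates `j` w.r.t. `σ`,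
then `σ ∉ FP(G|_(σ ∪ {k}))` and `σ ∉ FP(G)`. -/
theorem domination_outside_in {n : ℕ} (hn : 1 ≤ n) (E : Fin n → Fin n → Prop)
    (hirr : ∀ i, ¬ E i i) (ε δ θ : ℝ)
    (hθ : 0 < θ) (hδ : 0 < δ) (hε : 0 < ε) (hεδ : ε < δ / (δ + 1))
    (σ : Finset (Fin n)) (j k : Fin n) (hjk : j ≠ k)
    (hj : j ∈ σ) (hk : k ∉ σ) (hdom : Dominates E σ k j) :
    σ.subtype (· ∈ insert k σ) ∉
      FP (fun a b : {x // x ∈ insert k σ} => E a.1 b.1) ε δ θ ∧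
    σ ∉ FP E ε δ θ := by
  refine ⟨?_, dom_aux E ε δ θ hδ hε σ j k hjk hj hk hdom⟩
  have hjm : j ∈ insert k σ := Finset.mem_insert_of_mem hj
  have hkm : k ∈ insert k σ := Finset.mem_insert_self k σ
  obtain ⟨-, h1, h2, -⟩ := hdom
  refine dom_aux _ ε δ θ hδ hε _ ⟨j, hjm⟩ ⟨k, hkm⟩ (fun e => hjk (congrArg Subtype.val e))
    (Finset.mem_subtype.2 hj) (fun e => hk (Finset.mem_subtype.1 e)) ⟨?_, ?_, ?_, ?_⟩
  · exact Or.inl (Finset.mem_subtype.2 hj)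
  · intro i hi hij hik
    exact h1 i.1 (Finset.mem_subtype.1 hi) (fun e => hij (Subtype.ext e))
      (fun e => hik (Subtype.ext e))
  · exact fun _ => h2 hj
  · exact fun e => absurd (Finset.mem_subtype.1 e) hk
end

section
/- (Inside-out domination) Suppose j ∉ σ, k ∈ σ, and k dominates j with respect to σ. Then σ ∈ FP(G|_{σ∪{j}}) if and only if σ ∈ FP(G|σ). -/
open scoped Classical

theorem mem_FP_restrict {n : ℕ} (E : Fin n → Fin n → Prop) (ε δ θ : ℝ)
    (σ τ : Finset (Fin n)) (h : σ ⊆ τ) :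
    σ.subtype (· ∈ τ) ∈ FP (fun a b : {x // x ∈ τ} => E a.1 b.1) ε δ θ ↔
      ∃ y : Fin n → ℝ,
        (∀ i ∈ σ, 0 < y i ∧ y i = (∑ l ∈ σ, ctlnW E ε δ i l * y l) + θ) ∧
        (∀ i ∈ τ, i ∉ σ → (∑ l ∈ σ, ctlnW E ε δ i l * y l) + θ ≤ 0) := by
  have hW : ∀ a b : {x // x ∈ τ},
      ctlnW (fun a b : {x // x ∈ τ} => E a.1 b.1) ε δ a b = ctlnW E ε δ a.1 b.1 := by
    intro a b
    by_cases hab : a = b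
    · subst hab
      simp [ctlnW]
    · have hab' : a.1 ≠ b.1 := fun hc => hab (Subtype.ext hc)
      simp only [ctlnW, if_neg hab, if_neg hab']
  have hsum : ∀ (y : Fin n → ℝ), (∀ i ∈ τ, i ∉ σ → y i = 0) → ∀ i : Fin n,
      (∑ l : {x // x ∈ τ}, ctlnW E ε δ i l.1 * y l.1)
        = ∑ l ∈ σ, ctlnW E ε δ i l * y l := by
    intro y hy i
    rw [Finset.sum_coe_sort τ (fun l => ctlnW E ε δ i l * y l)]
    symm
    apply Finset.sum_subset h
    intro l hl hl'
    rw [hy l hl hl', mul_zero]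
  simp only [FP, Finset.mem_filter, Finset.mem_univ, true_and, IsCTLNFixedPoint, hW]
  constructor
  · rintro ⟨x, hx, hs⟩
    have hs' : ∀ a : {x // x ∈ τ}, x a ≠ 0 ↔ a.1 ∈ σ := by
      intro a
      have := Finset.ext_iff.mp hs a
      simpa using this
    let y : Fin n → ℝ := fun i => if hi : i ∈ τ then x ⟨i, hi⟩ else 0
    have hxy : ∀ a : {x // x ∈ τ}, x a = y a.1 := by
      intro a
      simp [y, a.2]
    have hy0 : ∀ i ∈ τ, i ∉ σ → y i = 0 := by
      intro i hi hi'
      have := hs' ⟨i, hi⟩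
      rw [hxy] at this
      by_contra hc
      exact hi' (this.mp hc)
    have hfp : ∀ i ∈ τ, y i = max 0 ((∑ l ∈ σ, ctlnW E ε δ i l * y l) + θ) := by
      intro i hi
      have := hx ⟨i, hi⟩
      simp only [hxy] at this
      rwa [hsum y hy0 i] at this
    refine ⟨y, fun i hi => ?_, fun i hi hi' => ?_⟩
    · have h1 := hfp i (h hi)
      have h2 : y i ≠ 0 := by
        have := (hs' ⟨i, h hi⟩).mpr hi
        rwa [hxy] at this
      rcases max_cases 0 ((∑ l ∈ σ, ctlnW E ε δ i l * y l) + θ) with h3 | h3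
      · exact absurd (h1.trans h3.1) h2
      · exact ⟨by linarith, by linarith⟩
    · have h1 := hfp i hi
      rw [hy0 i hi hi'] at h1
      exact max_eq_left_iff.mp h1.symm
  · rintro ⟨z, hz1, hz2⟩
    let y : Fin n → ℝ := fun i => if i ∈ σ then z i else 0
    have hy0 : ∀ i ∈ τ, i ∉ σ → y i = 0 := fun i _ hi' => by simp [y, hi']
    have hyz : ∀ i ∈ σ, y i = z i := fun i hi => by simp [y, hi]
    have hsz : ∀ i, (∑ l ∈ σ, ctlnW E ε δ i l * y l) = ∑ l ∈ σ, ctlnW E ε δ i l * z l :=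
      fun i => Finset.sum_congr rfl fun l hl => by rw [hyz l hl]
    refine ⟨fun a => y a.1, fun a => ?_, ?_⟩
    · rw [hsum y hy0 a.1, hsz]
      beta_reduce
      by_cases ha : a.1 ∈ σ
      · obtain ⟨h1, h2⟩ := hz1 a.1 ha
        rw [hyz _ ha, ← h2, max_eq_right h1.le]
      · rw [hy0 _ a.2 ha, max_eq_left (hz2 _ a.2 ha)]
    · ext a
      simp only [Finset.mem_filter, Finset.mem_univ, true_and, Finset.mem_subtype]
      by_cases ha : a.1 ∈ σ
      · simp [ha, hyz _ ha, (hz1 _ ha).1.ne']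
      · simp [ha, hy0 _ a.2 ha]

/-- Inside-out domination: if `j ∉ σ`, `k ∈ σ` and `k` dominates `j` w.r.t. `σ`,
then `σ ∈ FP(G|_(σ ∪ {j})) ↔ σ ∈ FP(G|_σ)`. -/
theorem domination_inside_out {n : ℕ} (hn : 1 ≤ n) (E : Fin n → Fin n → Prop)
    (hirr : ∀ i, ¬ E i i) (ε δ θ : ℝ)
    (hθ : 0 < θ) (hδ : 0 < δ) (hε : 0 < ε) (hεδ : ε < δ / (δ + 1))
    (σ : Finset (Fin n)) (j k : Fin n) (hjk : j ≠ k)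
    (hj : j ∉ σ) (hk : k ∈ σ) (hdom : Dominates E σ k j) :
    (σ.subtype (· ∈ insert j σ) ∈
        FP (fun a b : {x // x ∈ insert j σ} => E a.1 b.1) ε δ θ ↔
      σ.subtype (· ∈ σ) ∈ FP (fun a b : {x // x ∈ σ} => E a.1 b.1) ε δ θ) := by
  rw [mem_FP_restrict E ε δ θ σ (insert j σ) (Finset.subset_insert j σ),
    mem_FP_restrict E ε δ θ σ σ (Finset.Subset.refl σ)]
  constructor
  · rintro ⟨y, h1, -⟩
    exact ⟨y, h1, fun i hi hi' => absurd hi hi'⟩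
  · rintro ⟨y, h1, -⟩
    refine ⟨y, h1, fun i hi hi' => ?_⟩
    obtain rfl : i = j := by
      rcases Finset.mem_insert.mp hi with h | h
      · exact h
      · exact absurd h hi'
    obtain ⟨-, hd1, -, hd3⟩ := hdom
    obtain ⟨hkpos, hkeq⟩ := h1 k hk
    have e1 := Finset.add_sum_erase σ (fun l => ctlnW E ε δ k l * y l) hk
    have e2 := Finset.add_sum_erase σ (fun l => ctlnW E ε δ i l * y l) hk
    have hle : ∑ l ∈ σ.erase k, ctlnW E ε δ i l * y l
        ≤ ∑ l ∈ σ.erase k, ctlnW E ε δ k l * y l := by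
      apply Finset.sum_le_sum
      intro l hl
      obtain ⟨hlk, hl⟩ := Finset.mem_erase.mp hl
      apply mul_le_mul_of_nonneg_right _ (h1 l hl).1.le
      have hli : l ≠ i := fun h => hj (h ▸ hl)
      have := hd1 l hl hli hlk
      simp only [ctlnW, if_neg hli.symm, if_neg hlk.symm]
      split_ifs with ha hb hb
      · exact le_rfl
      · exact absurd (this ha) hb
      · linarith
      · exact le_rfl
    have w1 : ctlnW E ε δ k k = 0 := by simp [ctlnW]
    have w2 : ctlnW E ε δ i k = -1 - δ := by simp [ctlnW, hjk, hd3 hk]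
    simp only [w1, w2] at e1 e2
    have := mul_pos hδ hkpos
    linarith
end

section
/- If G is the graph on n nodes with no edges (an independent set of n nodes), then FP(G) consists of all nonempty subsets of [n]; in particular |FP(G)| = 2^n − 1. -/
open scoped Classical

/-- For the graph with no edges, `FP(G)` is all nonempty subsets, so
`|FP(G)| = 2^n - 1`. -/
theorem independent_graph_FP {n : ℕ} (hn : 1 ≤ n) (E : Fin n → Fin n → Prop)
    (hirr : ∀ i, ¬ E i i) (ε δ θ : ℝ)
    (hθ : 0 < θ) (hδ : 0 < δ) (hε : 0 < ε) (hεδ : ε < δ / (δ + 1))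
    (hE : ∀ i j, ¬ E i j) :
    (∀ σ : Finset (Fin n), σ ∈ FP E ε δ θ ↔ σ.Nonempty) ∧
    (FP E ε δ θ).card = 2 ^ n - 1 := by
  have hsum : ∀ (x : Fin n → ℝ) (i : Fin n),
      ∑ j, ctlnW E ε δ i j * x j = (1 + δ) * x i - (1 + δ) * ∑ j, x j := by
    intro x i
    have h1 : ∀ j, ctlnW E ε δ i j * x j
        = (if i = j then (1 + δ) * x j else 0) - (1 + δ) * x j := by
      intro j
      unfold ctlnW
      rw [if_neg (hE j i)]
      split_ifs <;> ring
    rw [Finset.sum_congr rfl (fun j _ => h1 j), Finset.sum_sub_distrib,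
      ← Finset.mul_sum, Finset.sum_ite_eq]
    simp
  have key : ∀ σ : Finset (Fin n), σ ∈ FP E ε δ θ ↔ σ.Nonempty := by
    intro σ
    simp only [FP, Finset.mem_filter, Finset.mem_univ, true_and]
    constructor
    · rintro ⟨x, hx, rfl⟩
      by_contra hne
      rw [Finset.not_nonempty_iff_eq_empty] at hne
      have h0 : ∀ i, x i = 0 := by
        intro i
        by_contra hi
        have : i ∈ (Finset.univ.filter fun i => x i ≠ 0) := by simp [hi]
        rw [hne] at this
        simp at this
      have h := hx ⟨0, hn⟩
      rw [hsum] at h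
      simp only [h0, Finset.sum_const_zero, mul_zero, sub_zero, zero_add] at h
      have := le_max_right 0 θ
      linarith
    · intro hσ
      have hk : (1 : ℝ) ≤ σ.card := by exact_mod_cast hσ.card_pos
      have hD : 0 < (1 + δ) * (σ.card : ℝ) - δ := by nlinarith
      obtain ⟨c, hc⟩ : ∃ c, c = θ / ((1 + δ) * (σ.card : ℝ) - δ) := ⟨_, rfl⟩
      have hcpos : 0 < c := by rw [hc]; positivity
      have hcθ : c * ((1 + δ) * (σ.card : ℝ) - δ) = θ := by
        rw [hc]; exact div_mul_cancel₀ _ hD.ne'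
      refine ⟨fun i => if i ∈ σ then c else 0, ?_, ?_⟩
      · intro i
        have hS : ∑ j, (if j ∈ σ then c else 0) = (σ.card : ℝ) * c := by
          simp [Finset.sum_ite_mem]
        rw [hsum]
        simp only [hS]
        by_cases hi : i ∈ σ
        · simp only [hi, if_true]
          rw [max_eq_right] <;> nlinarith
        · simp only [hi, if_false]
          rw [max_eq_left]
          nlinarith [mul_pos hδ hcpos]
      · ext i
        simp [hcpos.ne']
  refine ⟨key, ?_⟩
  have : FP E ε δ θ = Finset.univ.erase ∅ := by
    ext σ
    rw [key σ]
    simp [Finset.nonempty_iff_ne_empty]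
  rw [this, Finset.card_erase_of_mem (Finset.mem_univ _)]
  simp
end

section
/- If G has s sinks (nodes with no outgoing edges), then |FP(G)| ≥ 2^s − 1; indeed every nonempty subset of the set of sinks belongs to FP(G). -/
open scoped Classical

/-- If `G` has `s` sinks, then every nonempty subset of the set of sinks is in
`FP(G)`, so `|FP(G)| ≥ 2^s - 1`. -/
theorem sinks_FP_lower_bound {n : ℕ} (hn : 1 ≤ n) (E : Fin n → Fin n → Prop)
    (hirr : ∀ i, ¬ E i i) (ε δ θ : ℝ)
    (hθ : 0 < θ) (hδ : 0 < δ) (hε : 0 < ε) (hεδ : ε < δ / (δ + 1))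
    (s : ℕ) (hs : (Finset.univ.filter fun i : Fin n => ∀ j, ¬ E i j).card = s) :
    (∀ σ : Finset (Fin n), σ.Nonempty → (∀ i ∈ σ, ∀ j, ¬ E i j) →
        σ ∈ FP E ε δ θ) ∧
    2 ^ s - 1 ≤ (FP E ε δ θ).card := by
  have key : ∀ σ : Finset (Fin n), σ.Nonempty → (∀ i ∈ σ, ∀ j, ¬ E i j) →
        σ ∈ FP E ε δ θ := by
    intro σ hσ hsink
    have hk : (1 : ℝ) ≤ (σ.card : ℝ) := by exact_mod_cast hσ.card_pos
    have hD : 0 < (σ.card : ℝ) * (1 + δ) - δ := by nlinarith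
    obtain ⟨c, hc⟩ : ∃ c : ℝ, c = θ / ((σ.card : ℝ) * (1 + δ) - δ) := ⟨_, rfl⟩
    have hc0 : 0 < c := by rw [hc]; positivity
    have hcθ : c * ((σ.card : ℝ) * (1 + δ) - δ) = θ := by
      rw [hc]; field_simp
    unfold FP
    rw [Finset.mem_filter]
    refine ⟨Finset.mem_univ _, fun i => if i ∈ σ then c else 0, ?_, ?_⟩
    · intro i
      have h1 : ∀ j, ctlnW E ε δ i j * (if j ∈ σ then c else 0) =
          (if j ∈ σ then (-1 - δ) * c else 0) +
          (if i = j then (if i ∈ σ then (1 + δ) * c else 0) else 0) := by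
        intro j
        unfold ctlnW
        by_cases hij : i = j
        · subst hij
          by_cases hi : i ∈ σ
          · simp [hi]; ring
          · simp [hi]
        · by_cases hj : j ∈ σ
          · simp [hij, hj, hsink j hj i]
          · simp [hij, hj]
      have h2 : ∑ j, ctlnW E ε δ i j * (if j ∈ σ then c else 0) =
          (σ.card : ℝ) * ((-1 - δ) * c) + (if i ∈ σ then (1 + δ) * c else 0) := by
        rw [Finset.sum_congr rfl (fun j _ => h1 j), Finset.sum_add_distrib]
        simp
      show (if i ∈ σ then c else 0) =
        max 0 ((∑ j, ctlnW E ε δ i j * (if j ∈ σ then c else 0)) + θ)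
      rw [h2]
      by_cases hi : i ∈ σ
      · simp only [hi, if_true]
        rw [max_eq_right] <;> nlinarith
      · simp only [hi, if_false]
        rw [max_eq_left]
        nlinarith [mul_pos hδ hc0]
    · ext i
      simp [hc0.ne']
  refine ⟨key, ?_⟩
  rw [← hs, ← Finset.card_powerset, ← Finset.card_erase_of_mem (Finset.empty_mem_powerset _)]
  apply Finset.card_le_card
  intro σ hσ
  rw [Finset.mem_erase, Finset.mem_powerset] at hσ
  exact key σ (Finset.nonempty_iff_ne_empty.mpr hσ.1)
    (fun i hi => (Finset.mem_filter.mp (hσ.2 hi)).2)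
end

section
/- Let n ≥ 2 and let G be the directed n-cycle, whose only edges are i → i+1 (indices mod n). Then the CTLN has a unique fixed point, and its support is all of [n]; that is, FP(G) = {[n]}. -/
open scoped Classical

lemma cyc_sum {m : ℕ} (E : Fin (m+2) → Fin (m+2) → Prop) (ε δ : ℝ)
    (hE : ∀ i j, E i j ↔ j = i + 1) (x : Fin (m+2) → ℝ) (i : Fin (m+2)) :
    ∑ j, ctlnW E ε δ (i+1) j * x j
      = -(1+δ) * (∑ j, x j) + (1+δ) * x (i+1) + (ε+δ) * x i := by
  have hne : i + 1 ≠ i := by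
    intro h
    simp at h
  have h : ∀ j, ctlnW E ε δ (i+1) j * x j
      = -(1+δ) * x j + (if j = i+1 then (1+δ) * x j else 0)
        + (if j = i then (ε+δ) * x j else 0) := by
    intro j
    unfold ctlnW
    by_cases h1 : j = i + 1
    · subst h1
      simp [hne]
      ring
    · by_cases h2 : j = i
      · subst h2
        simp [hE, h1, hne]
        ring
      · have h3 : ¬ (i + 1 = j + 1) := fun h => h2 (by simpa using h.symm)
        have h4 : ¬ (i + 1 = j) := fun h => h1 h.symm
        simp only [hE, h1, h2, h3, h4, if_false]
        ring
  rw [Finset.sum_congr rfl (fun j _ => h j), Finset.sum_add_distrib, Finset.sum_add_distrib,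
    ← Finset.mul_sum]
  simp

open scoped Fin.NatCast in
lemma cyc_all {m : ℕ} (P : Fin (m+2) → Prop) (h : ∀ i, P i → P (i+1)) (i : Fin (m+2))
    (hi : P i) (j : Fin (m+2)) : P j := by
  have key : ∀ k : ℕ, P (i + (k : Fin (m+2))) := by
    intro k
    induction k with
    | zero => simpa using hi
    | succ k ih =>
      have := h _ ih
      rw [add_assoc] at this
      simpa using this
  have := key (j - i).val
  rw [Fin.cast_val_eq_self] at this
  simpa using this

lemma cyc_unique {m : ℕ} (E : Fin (m+2) → Fin (m+2) → Prop) (ε δ θ : ℝ)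
    (hθ : 0 < θ) (hδ : 0 < δ) (hε : 0 < ε)
    (hE : ∀ i j, E i j ↔ j = i + 1) (x : Fin (m+2) → ℝ)
    (hx : IsCTLNFixedPoint E ε δ θ x) (i : Fin (m+2)) :
    0 < x i ∧ x i * ((1+δ) * (m+2) - 2*δ - ε) = θ := by
  obtain ⟨a, ha⟩ : ∃ a, a = (1+δ) * (∑ j, x j) - θ := ⟨_, rfl⟩
  have hf : ∀ i, x (i+1) = max 0 ((1+δ) * x (i+1) + (ε+δ) * x i - a) := by
    intro i
    have := hx (i+1)
    rw [cyc_sum E ε δ hE] at this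
    rw [ha]
    convert this using 2
    ring
  have hnn : ∀ i, 0 ≤ x i := fun i => by rw [hx i]; exact le_max_left _ _
  have hle : ∀ i, δ * x (i+1) + (ε+δ) * x i ≤ a := by
    intro i
    have := le_max_right 0 ((1+δ) * x (i+1) + (ε+δ) * x i - a)
    rw [← hf i] at this
    linarith
  have heq : ∀ i, 0 < x (i+1) → δ * x (i+1) + (ε+δ) * x i = a := by
    intro i h
    rcases max_choice 0 ((1+δ) * x (i+1) + (ε+δ) * x i - a) with h' | h'
    · rw [← hf i] at h'; linarith
    · rw [← hf i] at h'; linarith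
  have hz : ∀ i, x i = 0 → x (i+1) = 0 := by
    intro i h0
    by_contra hne
    have hp : 0 < x (i+1) := lt_of_le_of_ne (hnn _) (Ne.symm hne)
    have h1 := heq i hp
    have h2 := hle (i+1)
    have h3 := mul_nonneg hδ.le (hnn (i+1+1))
    have h4 := mul_pos hε hp
    rw [h0] at h1
    nlinarith
  have hpos : ∀ i, 0 < x i := by
    intro i
    refine lt_of_le_of_ne (hnn _) (fun h => ?_)
    have hall := cyc_all (fun i => x i = 0) hz i h.symm
    have h1 := hle i
    simp only [hall, Finset.sum_const_zero] at ha h1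
    linarith
  have hall : ∀ i, δ * x (i+1) + (ε+δ) * x i = a := fun i => heq i (hpos _)
  obtain ⟨c, hc⟩ : ∃ c, c = a / (2*δ+ε) := ⟨_, rfl⟩
  have hca : c * (2*δ+ε) = a := by rw [hc]; field_simp
  have hconst : ∀ i, x i = c := by
    obtain ⟨k, hk⟩ := Finite.exists_max (fun i => |x i - c|)
    have h1 : δ * (x (k+1) - c) = -((ε+δ) * (x k - c)) := by linarith [hall k]
    have h2 : δ * |x (k+1) - c| = (ε+δ) * |x k - c| := by
      have := congrArg abs h1
      rwa [abs_neg, abs_mul, abs_mul, abs_of_pos hδ, abs_of_pos (add_pos hε hδ)] at this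
    have h3 := mul_le_mul_of_nonneg_left (hk (k+1)) hδ.le
    have h4 : ε * |x k - c| ≤ 0 := by linarith
    have h5 : |x k - c| ≤ 0 := by
      by_contra h
      push Not at h
      linarith [mul_pos hε h]
    intro i
    have h6 : |x i - c| ≤ 0 := (hk i).trans h5
    have := abs_nonpos_iff.mp h6
    linarith
  refine ⟨hpos i, ?_⟩
  simp only [hconst] at ha ⊢
  simp at ha
  linarith

lemma cyc_exists {m : ℕ} (E : Fin (m+2) → Fin (m+2) → Prop) (ε δ θ c : ℝ)
    (hE : ∀ i j, E i j ↔ j = i + 1) (hc : 0 < c)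
    (h : c * ((1+δ) * (m+2) - 2*δ - ε) = θ) :
    IsCTLNFixedPoint E ε δ θ (fun _ => c) := by
  intro i
  obtain ⟨j, rfl⟩ : ∃ j, i = j + 1 := ⟨i - 1, by simp⟩
  rw [cyc_sum E ε δ hE]
  have : -(1+δ) * (∑ _j : Fin (m+2), c) + (1+δ) * c + (ε+δ) * c + θ = c := by
    simp
    linarith
  rw [this, max_eq_right hc.le]

/-- The directed `n`-cycle (`n ≥ 2`, edges `i → i+1 (mod n)`) has a unique fixed point, whose support is
the full vertex set: `FP(G) = {[n]}`. -/
theorem cycle_unique_fixed_point {n : ℕ} (hn : 1 ≤ n) (E : Fin n → Fin n → Prop)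
    (hirr : ∀ i, ¬ E i i) (ε δ θ : ℝ)
    (hθ : 0 < θ) (hδ : 0 < δ) (hε : 0 < ε) (hεδ : ε < δ / (δ + 1))
    (hn2 : 2 ≤ n) (hE : ∀ i j, E i j ↔ (j : ℕ) = ((i : ℕ) + 1) % n) :
    (∃! x : Fin n → ℝ, IsCTLNFixedPoint E ε δ θ x) ∧
    FP E ε δ θ = {Finset.univ} := by
  obtain ⟨m, rfl⟩ : ∃ m, n = m + 2 := ⟨n - 2, by omega⟩
  have hE' : ∀ i j, E i j ↔ j = i + 1 := by
    intro i j
    rw [hE, Fin.ext_iff, Fin.val_add]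
    simp
  have hε1 : ε < 1 := hεδ.trans ((div_lt_one (by linarith)).2 (by linarith))
  have hD : 0 < (1+δ) * ((m:ℝ)+2) - 2*δ - ε := by
    have : 0 ≤ (1+δ) * (m:ℝ) := by positivity
    linarith
  obtain ⟨c, hc⟩ : ∃ c, c = θ / ((1+δ) * ((m:ℝ)+2) - 2*δ - ε) := ⟨_, rfl⟩
  have hc0 : 0 < c := by rw [hc]; positivity
  have hcD : c * ((1+δ) * ((m:ℝ)+2) - 2*δ - ε) = θ := by rw [hc]; exact div_mul_cancel₀ _ hD.ne'
  have hex := cyc_exists E ε δ θ c hE' hc0 hcD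
  have hun := cyc_unique E ε δ θ hθ hδ hε hE'
  refine ⟨⟨fun _ => c, hex, ?_⟩, ?_⟩
  · intro y hy
    funext i
    exact mul_right_cancel₀ hD.ne' ((hun y hy i).2.trans hcD.symm)
  · ext σ
    simp only [FP, Finset.mem_filter, Finset.mem_univ, true_and, Finset.mem_singleton]
    constructor
    · rintro ⟨x, hx, rfl⟩
      ext i
      simp [(hun x hx i).1.ne']
    · rintro rfl
      refine ⟨_, hex, ?_⟩
      ext i
      simp [hc0.ne']
end
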